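/- (Theorem 3, opportunity bound.) Let λ ∈ [0,1] and let σ, σ̄ : S → P_ℬ be opponent strategy kernels. Let V* = V^{*,σ} and V̄ = V^{*,σ̄} be the optimal value functions against σ and σ̄, and suppose V̄(s) ≥ ν for all s. Let π : S → P_𝒜 be the value-based strategy built with correct beliefs (σ̃ = σ): for every s and every distribution x on 𝒜, λ(E_{π(s),σ(s)}[r](s) + γE_{p,π(s),σ(s)}[V*](s)) + (1−λ)(E_{π(s),σ̄(s)}[r](s) + γE_{p,π(s),σ̄(s)}[V̄](s)) ≥ the same expression with x in place of π(s). Assume V^{π,σ}(s) ≥ V^{π,σ̄}(s) for all s. Then max_s (V^{*,σ}(s) − V^{π,σ}(s)) ≤ ((1−λ)/(1−λγ))·(((γ²−3γ+6)/(1−γ)²)·r_max − γν). -/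

import Mathlib

open Finset

noncomputable section

/-- `x` is a probability distribution on the finite type `α`. -/
def IsProb {α : Type*} [Fintype α] (x : α → ℝ) : Prop :=
  (∀ i, 0 ≤ x i) ∧ ∑ i, x i = 1

/-- Expected one-step reward `E_{x,ς}[r](s) = Σ_{a,a'} x(a) ς(a') r(s,a,a')`. -/
def Er {S A B : Type*} [Fintype A] [Fintype B]
    (r : S → A → B → ℝ) (x : A → ℝ) (ς : B → ℝ) (s : S) : ℝ :=
  ∑ a, ∑ a', x a * ς a' * r s a a'

/-- Expected next-state value
`E_{p,x,ς}[V](s) = Σ_{a,a',s'} x(a) ς(a') p(s'|s,a,a') V(s')`. -/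
def Ep {S A B : Type*} [Fintype S] [Fintype A] [Fintype B]
    (p : S → A → B → S → ℝ) (x : A → ℝ) (ς : B → ℝ) (V : S → ℝ) (s : S) : ℝ :=
  ∑ a, ∑ a', ∑ s', x a * ς a' * p s a a' s' * V s'

/-- `V` satisfies the Bellman equation of the pair `(π, σ)`:
`V(s) = E_{π(s),σ(s)}[r](s) + γ E_{p,π(s),σ(s)}[V](s)`. -/
def IsValue {S A B : Type*} [Fintype S] [Fintype A] [Fintype B]
    (p : S → A → B → S → ℝ) (r : S → A → B → ℝ) (γ : ℝ)
    (π : S → A → ℝ) (σ : S → B → ℝ) (V : S → ℝ) : Prop :=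
  ∀ s, V s = Er r (π s) (σ s) s + γ * Ep p (π s) (σ s) V s

/-- `V` satisfies the Bellman optimality equation against the opponent kernel `σ`:
`V(s) = max_{a} Σ_{a'} σ(s)(a') (r(s,a,a') + γ Σ_{s'} p(s'|s,a,a') V(s'))`. -/
def IsOptValue {S A B : Type*} [Fintype S] [Fintype A] [Fintype B] [Nonempty A]
    (p : S → A → B → S → ℝ) (r : S → A → B → ℝ) (γ : ℝ)
    (σ : S → B → ℝ) (V : S → ℝ) : Prop :=
  ∀ s, V s = Finset.univ.sup' Finset.univ_nonempty (fun a =>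
    ∑ a', σ s a' * (r s a a' + γ * ∑ s', p s a a' s' * V s'))

lemma Ep_sub' {S A B : Type*} [Fintype S] [Fintype A] [Fintype B]
    (p : S → A → B → S → ℝ) (x : A → ℝ) (ς : B → ℝ) (V W : S → ℝ) (s : S) :
    Ep p x ς (fun t => V t - W t) s = Ep p x ς V s - Ep p x ς W s := by
  simp only [Ep, mul_sub, Finset.sum_sub_distrib]

lemma Er_const' {S A B : Type*} [Fintype A] [Fintype B]
    (x : A → ℝ) (ς : B → ℝ) (hx : IsProb x) (hς : IsProb ς) (c : ℝ) (s : S) :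
    Er (fun _ _ _ => c) x ς s = c := by
  simp only [Er, ← Finset.sum_mul, ← Finset.mul_sum, hς.2, hx.2, mul_one, one_mul]

lemma Er_mono' {S A B : Type*} [Fintype A] [Fintype B]
    (r r' : S → A → B → ℝ) (x : A → ℝ) (ς : B → ℝ) (hx : IsProb x) (hς : IsProb ς) (s : S)
    (h : ∀ a b, r s a b ≤ r' s a b) : Er r x ς s ≤ Er r' x ς s :=
  Finset.sum_le_sum fun a _ => Finset.sum_le_sum fun b _ =>
    mul_le_mul_of_nonneg_left (h a b) (mul_nonneg (hx.1 a) (hς.1 b))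

lemma Ep_eq' {S A B : Type*} [Fintype S] [Fintype A] [Fintype B]
    (p : S → A → B → S → ℝ) (x : A → ℝ) (ς : B → ℝ) (V : S → ℝ) (s : S) :
    Ep p x ς V s = Er (fun s a b => ∑ s', p s a b s' * V s') x ς s := by
  simp only [Ep, Er, Finset.mul_sum, mul_assoc]

lemma Er_le' {S A B : Type*} [Fintype A] [Fintype B]
    (r : S → A → B → ℝ) (x : A → ℝ) (ς : B → ℝ) (hx : IsProb x) (hς : IsProb ς) (s : S) (c : ℝ)
    (h : ∀ a b, r s a b ≤ c) : Er r x ς s ≤ c :=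
  (Er_mono' r (fun _ _ _ => c) x ς hx hς s h).trans_eq (Er_const' x ς hx hς c s)

lemma le_Er' {S A B : Type*} [Fintype A] [Fintype B]
    (r : S → A → B → ℝ) (x : A → ℝ) (ς : B → ℝ) (hx : IsProb x) (hς : IsProb ς) (s : S) (c : ℝ)
    (h : ∀ a b, c ≤ r s a b) : c ≤ Er r x ς s :=
  (Er_const' x ς hx hς c s).symm.trans_le (Er_mono' (fun _ _ _ => c) r x ς hx hς s h)

lemma Ep_le' {S A B : Type*} [Fintype S] [Fintype A] [Fintype B]
    (p : S → A → B → S → ℝ) (hp0 : ∀ s a a' s', 0 ≤ p s a a' s')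
    (hp1 : ∀ s a a', ∑ s', p s a a' s' = 1)
    (x : A → ℝ) (ς : B → ℝ) (hx : IsProb x) (hς : IsProb ς) (V : S → ℝ) (s : S) (c : ℝ)
    (h : ∀ t, V t ≤ c) : Ep p x ς V s ≤ c := by
  rw [Ep_eq']
  refine Er_le' _ x ς hx hς s c fun a b => ?_
  calc ∑ s', p s a b s' * V s' ≤ ∑ s', p s a b s' * c :=
        Finset.sum_le_sum fun t _ => mul_le_mul_of_nonneg_left (h t) (hp0 s a b t)
    _ = c := by rw [← Finset.sum_mul, hp1, one_mul]

lemma le_Ep' {S A B : Type*} [Fintype S] [Fintype A] [Fintype B]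
    (p : S → A → B → S → ℝ) (hp0 : ∀ s a a' s', 0 ≤ p s a a' s')
    (hp1 : ∀ s a a', ∑ s', p s a a' s' = 1)
    (x : A → ℝ) (ς : B → ℝ) (hx : IsProb x) (hς : IsProb ς) (V : S → ℝ) (s : S) (c : ℝ)
    (h : ∀ t, c ≤ V t) : c ≤ Ep p x ς V s := by
  rw [Ep_eq']
  refine le_Er' _ x ς hx hς s c fun a b => ?_
  calc c = ∑ s', p s a b s' * c := by rw [← Finset.sum_mul, hp1, one_mul]
    _ ≤ ∑ s', p s a b s' * V s' :=
        Finset.sum_le_sum fun t _ => mul_le_mul_of_nonneg_left (h t) (hp0 s a b t)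

lemma opt_exists' {S A B : Type*} [Fintype S] [Fintype A] [Fintype B] [Nonempty A]
    (p : S → A → B → S → ℝ) (r : S → A → B → ℝ) (γ : ℝ)
    (σ : S → B → ℝ) (V : S → ℝ) (hV : IsOptValue p r γ σ V) (s : S) :
    ∃ x : A → ℝ, IsProb x ∧ V s = Er r x (σ s) s + γ * Ep p x (σ s) V s := by
  classical
  obtain ⟨a, -, ha⟩ := Finset.exists_mem_eq_sup' (Finset.univ_nonempty (α := A)) (fun a =>
    ∑ a', σ s a' * (r s a a' + γ * ∑ s', p s a a' s' * V s'))
  refine ⟨fun b => if b = a then 1 else 0, ⟨fun i => by dsimp only; split_ifs <;> norm_num, by simp⟩, ?_⟩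
  rw [hV s, ha, Ep_eq']
  have key : ∀ f : S → A → B → ℝ, Er f (fun b => if b = a then (1:ℝ) else 0) (σ s) s
      = ∑ b, σ s b * f s a b := by
    intro f
    unfold Er
    rw [Finset.sum_eq_single a]
    · simp
    · intro b _ hb
      simp [hb]
    · simp
  rw [key, key, Finset.mul_sum, ← Finset.sum_add_distrib]
  exact Finset.sum_congr rfl fun b _ => by ring

lemma opt_le' {S A B : Type*} [Fintype S] [Fintype A] [Fintype B] [Nonempty S] [Nonempty A]
    (p : S → A → B → S → ℝ) (hp0 : ∀ s a a' s', 0 ≤ p s a a' s')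
    (hp1 : ∀ s a a', ∑ s', p s a a' s' = 1)
    (r : S → A → B → ℝ) (rmax : ℝ) (hr : ∀ s a a', |r s a a'| ≤ rmax)
    (γ : ℝ) (hγ0 : 0 ≤ γ) (hγ1 : γ < 1)
    (σ : S → B → ℝ) (hσ : ∀ s, IsProb (σ s)) (V : S → ℝ) (hV : IsOptValue p r γ σ V) (s : S) :
    V s ≤ rmax / (1 - γ) := by
  obtain ⟨t, ht⟩ := Finite.exists_max V
  obtain ⟨x, hx, h⟩ := opt_exists' p r γ σ V hV t
  have h1 := Er_le' r x (σ t) hx (hσ t) t rmax fun a b => (abs_le.1 (hr t a b)).2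
  have h2 := mul_le_mul_of_nonneg_left (Ep_le' p hp0 hp1 x (σ t) hx (hσ t) V t (V t) ht) hγ0
  refine (ht s).trans ?_
  rw [le_div_iff₀ (by linarith)]
  linarith

lemma val_ge' {S A B : Type*} [Fintype S] [Fintype A] [Fintype B] [Nonempty S]
    (p : S → A → B → S → ℝ) (hp0 : ∀ s a a' s', 0 ≤ p s a a' s')
    (hp1 : ∀ s a a', ∑ s', p s a a' s' = 1)
    (r : S → A → B → ℝ) (rmax : ℝ) (hr : ∀ s a a', |r s a a'| ≤ rmax)
    (γ : ℝ) (hγ0 : 0 ≤ γ) (hγ1 : γ < 1) (π : S → A → ℝ) (hπ : ∀ s, IsProb (π s))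
    (σ : S → B → ℝ) (hσ : ∀ s, IsProb (σ s)) (V : S → ℝ) (hV : IsValue p r γ π σ V) (s : S) :
    -(rmax / (1 - γ)) ≤ V s := by
  obtain ⟨t, ht⟩ := Finite.exists_min V
  have h := hV t
  have h1 := le_Er' r (π t) (σ t) (hπ t) (hσ t) t (-rmax) fun a b => (abs_le.1 (hr t a b)).1
  have h2 := mul_le_mul_of_nonneg_left
    (le_Ep' p hp0 hp1 (π t) (σ t) (hπ t) (hσ t) V t (V t) ht) hγ0
  refine le_trans ?_ (ht s)
  rw [← neg_div, div_le_iff₀ (by linarith)]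
  linarith

/-- **Theorem 3 (SBG Existence), opportunity bound:** with correct beliefs (`σ̃ = σ`), the
value-based strategy satisfies
`max_s (V^{*,σ}(s) − V^{π,σ}(s)) ≤ ((1−λ)/(1−λγ))·(((γ²−3γ+6)/(1−γ)²)·r_max − γν)`. -/
theorem sbg_opportunity_bound {S A B : Type*}
    [Fintype S] [Fintype A] [Fintype B] [Nonempty S] [Nonempty A] [Nonempty B]
    (p : S → A → B → S → ℝ) (hp0 : ∀ s a a' s', 0 ≤ p s a a' s')
    (hp1 : ∀ s a a', ∑ s', p s a a' s' = 1)
    (r : S → A → B → ℝ) (rmax : ℝ) (hr : ∀ s a a', |r s a a'| ≤ rmax)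
    (γ : ℝ) (hγ0 : 0 ≤ γ) (hγ1 : γ < 1)
    (lam : ℝ) (hlam0 : 0 ≤ lam) (hlam1 : lam ≤ 1)
    (σ σb : S → B → ℝ) (hσ : ∀ s, IsProb (σ s)) (hσb : ∀ s, IsProb (σb s))
    (Vstar Vb : S → ℝ)
    (hVstar : IsOptValue p r γ σ Vstar) (hVb : IsOptValue p r γ σb Vb)
    (ν : ℝ) (hν : ∀ s, ν ≤ Vb s)
    (π : S → A → ℝ) (hπ : ∀ s, IsProb (π s))
    (hvalue_based : ∀ s, ∀ x : A → ℝ, IsProb x →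
      lam * (Er r (π s) (σ s) s + γ * Ep p (π s) (σ s) Vstar s) +
        (1 - lam) * (Er r (π s) (σb s) s + γ * Ep p (π s) (σb s) Vb s) ≥
      lam * (Er r x (σ s) s + γ * Ep p x (σ s) Vstar s) +
        (1 - lam) * (Er r x (σb s) s + γ * Ep p x (σb s) Vb s))
    (Vπ Vπb : S → ℝ) (hVπ : IsValue p r γ π σ Vπ) (hVπb : IsValue p r γ π σb Vπb)
    (hdom : ∀ s, Vπb s ≤ Vπ s) :
    ∀ s, Vstar s - Vπ s ≤
      (1 - lam) / (1 - lam * γ) *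
        ((γ ^ 2 - 3 * γ + 6) / (1 - γ) ^ 2 * rmax - γ * ν) := by
  have h1γ : 0 < 1 - γ := by linarith
  have hlg : 0 < 1 - lam * γ := by nlinarith
  obtain ⟨s, hs⟩ := Finite.exists_max (fun t => Vstar t - Vπ t)
  intro s0
  refine (hs s0).trans ?_
  rw [div_mul_eq_mul_div, le_div_iff₀ hlg]
  have hR : 0 ≤ rmax := by
    obtain ⟨a⟩ := ‹Nonempty A›
    obtain ⟨b⟩ := ‹Nonempty B›
    exact (abs_nonneg _).trans (hr s a b)
  obtain ⟨x, hx, hxs⟩ := opt_exists' p r γ σ Vstar hVstar s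
  have hvb := hvalue_based s x hx
  rw [← hxs] at hvb
  have hV := hVπ s
  have hE := Ep_le' p hp0 hp1 (π s) (σ s) (hπ s) (hσ s) (fun t => Vstar t - Vπ t) s _ hs
  rw [Ep_sub'] at hE
  have b1 := Er_le' r (π s) (σb s) (hπ s) (hσb s) s rmax fun a b => (abs_le.1 (hr s a b)).2
  have b2 := mul_le_mul_of_nonneg_left (Ep_le' p hp0 hp1 (π s) (σb s) (hπ s) (hσb s) Vb s _
    (opt_le' p hp0 hp1 r rmax hr γ hγ0 hγ1 σb hσb Vb hVb)) hγ0
  have b3 := le_Er' r x (σb s) hx (hσb s) s (-rmax) fun a b => (abs_le.1 (hr s a b)).1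
  have b4 := mul_le_mul_of_nonneg_left
    (le_Ep' p hp0 hp1 x (σb s) hx (hσb s) Vb s ν hν) hγ0
  have b5 := opt_le' p hp0 hp1 r rmax hr γ hγ0 hγ1 σ hσ Vstar hVstar s
  have b6 := val_ge' p hp0 hp1 r rmax hr γ hγ0 hγ1 π hπ σ hσ Vπ hVπ s
  have hM : 2 * rmax + γ * (rmax / (1 - γ)) + 2 * (rmax / (1 - γ))
      ≤ (γ ^ 2 - 3 * γ + 6) / (1 - γ) ^ 2 * rmax := by
    have e : (γ ^ 2 - 3 * γ + 6) / (1 - γ) ^ 2 * rmax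
        - (2 * rmax + γ * (rmax / (1 - γ)) + 2 * (rmax / (1 - γ)))
        = (2 + 2 * γ) * rmax / (1 - γ) ^ 2 := by
      field_simp
      ring
    have : 0 ≤ (2 + 2 * γ) * rmax / (1 - γ) ^ 2 := by positivity
    linarith
  have hK : (Er r (π s) (σb s) s + γ * Ep p (π s) (σb s) Vb s)
      - (Er r x (σb s) s + γ * Ep p x (σb s) Vb s) + (Vstar s - Vπ s)
      ≤ (γ ^ 2 - 3 * γ + 6) / (1 - γ) ^ 2 * rmax - γ * ν := by linarith
  have hK' := mul_le_mul_of_nonneg_left hK (by linarith : 0 ≤ 1 - lam)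
  have hE' := mul_le_mul_of_nonneg_left hE (mul_nonneg hlam0 hγ0)
  have hV' : lam * Vπ s = lam * (Er r (π s) (σ s) s + γ * Ep p (π s) (σ s) Vπ s) := by
    rw [← hV]
  linarith
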